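/- arXiv:2012.04036 — 5 statements merged into one kernel-verified Lean document; each statement's English description precedes it below -/
import Mathlib

section
/- Let n ≥ 0 be a natural number and let p : ℝ → ℝ be a smooth (C^∞) function. Then p satisfies the identity ∑_{S ⊆ {0,1,…,n}} (−1)^{#S} · p(∑_{i∈S} x_i) = 0 for every collection of real numbers x_0, x_1, …, x_n if and only if p is the evaluation function of a polynomial of degree at most n. -/
open Polynomial in
theorem Polynomial.exists_derivative_eq_of_degree_lt {K : Type*} [Field K] [CharZero K]
    {q : K[X]} {m : ℕ} (hq : q.degree < m) :
    ∃ r : K[X], derivative r = q ∧ r.degree < (m + 1 : ℕ) := by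
  refine ⟨∑ i ∈ Finset.range m, monomial (i + 1) (q.coeff i / (i + 1)), ?_, ?_⟩
  · have hdeg : ∀ i ∈ Finset.range m,
        derivative (monomial (i + 1) (q.coeff i / (i + 1))) = monomial i (q.coeff i) := by
      intro i _
      have hi : (i : K) + 1 ≠ 0 := Nat.cast_add_one_ne_zero i
      rw [derivative_monomial, Nat.cast_add_one, div_mul_cancel₀ _ hi, Nat.add_sub_cancel]
    rw [derivative_sum, Finset.sum_congr rfl hdeg]
    by_cases h0 : q = 0
    · simp [h0]
    · exact (q.as_sum_range' m ((natDegree_lt_iff_degree_lt h0).2 hq)).symm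
  · rw [← mem_degreeLT]
    refine Submodule.sum_mem _ fun i hi => mem_degreeLT.2 ?_
    refine (degree_monomial_le _ _).trans_lt ?_
    exact_mod_cast Nat.succ_lt_succ (Finset.mem_range.1 hi)

theorem Finset.alternating_sum_powerset_cons {ι M R : Type*} [AddCommMonoid M] [Ring R]
    (f : M → R) (x : ι → M) {a : ι} {s : Finset ι} (ha : a ∉ s) :
    ∑ S ∈ (s.cons a ha).powerset, (-1 : R) ^ S.card * f (∑ i ∈ S, x i) =
      ∑ S ∈ s.powerset,
        (-1 : R) ^ S.card * (f (∑ i ∈ S, x i) - f (x a + ∑ i ∈ S, x i)) := by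
  classical
  rw [Finset.cons_eq_insert, Finset.sum_powerset_insert ha, ← Finset.sum_add_distrib]
  refine Finset.sum_congr rfl fun S hS => ?_
  have haS : a ∉ S := fun h => ha (Finset.mem_powerset.1 hS h)
  rw [Finset.card_insert_of_notMem haS, Finset.sum_insert haS, pow_succ]
  noncomm_ring

open Polynomial in
theorem Polynomial.alternating_sum_powerset_eval_eq_zero {ι R : Type*} [CommRing R]
    (s : Finset ι) (x : ι → R) (q : R[X]) (hq : q.degree < s.card) :
    ∑ S ∈ s.powerset, (-1 : R) ^ S.card * q.eval (∑ i ∈ S, x i) = 0 := by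
  induction s using Finset.cons_induction generalizing q with
  | empty =>
    have : q = 0 := by simpa [Nat.WithBot.lt_zero_iff] using hq
    simp [this]
  | cons a s ha ih =>
    rw [Finset.alternating_sum_powerset_cons (fun t => q.eval t)]
    by_cases h0 : q = 0
    · simp [h0]
    have hlt : (q - taylor (x a) q).degree < s.card := by
      have h := degree_sub_lt_left (degree_taylor q (x a)).symm h0 (leadingCoeff_taylor ..).symm
      refine h.trans_le ?_
      rw [Finset.card_cons] at hq
      rw [degree_eq_natDegree h0] at hq ⊢
      exact_mod_cast Nat.lt_succ_iff.1 (by exact_mod_cast hq)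
    simpa [taylor_eval, add_comm] using ih _ hlt

theorem exists_polynomial_of_alternating_sum_powerset_eq_zero {ι : Type*}
    {s : Finset ι} (hs : s.Nonempty) {p : ℝ → ℝ} (hp : ContDiff ℝ (⊤ : ℕ∞) p)
    (H : ∀ x : ι → ℝ, ∑ S ∈ s.powerset, (-1 : ℝ) ^ S.card * p (∑ i ∈ S, x i) = 0) :
    ∃ q : Polynomial ℝ, q.degree < s.card ∧ ∀ t, p t = q.eval t := by
  classical
  induction hs using Finset.Nonempty.cons_induction generalizing p with
  | singleton a =>
    refine ⟨Polynomial.C (p 0), ?_, fun t => ?_⟩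
    · exact Polynomial.degree_C_le.trans_lt (by simp)
    · have h := H fun _ => t
      rw [← Finset.cons_empty, Finset.alternating_sum_powerset_cons] at h
      simp at h
      simp
      linarith
  | cons a s ha hs ih =>
    obtain ⟨hd, hp'⟩ := contDiff_infty_iff_deriv.1 hp
    have key : ∀ x : ι → ℝ,
        ∑ S ∈ s.powerset, (-1 : ℝ) ^ S.card * deriv p (∑ i ∈ S, x i) = 0 := by
      intro x
      have hconst : ∀ h : ℝ, ∑ S ∈ s.powerset,
          (-1 : ℝ) ^ S.card * (p (∑ i ∈ S, x i) - p (h + ∑ i ∈ S, x i)) = 0 := by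
        intro h
        rw [← H (Function.update x a h), Finset.alternating_sum_powerset_cons]
        refine Finset.sum_congr rfl fun S hS => ?_
        rw [Finset.sum_update_of_notMem fun h => ha (Finset.mem_powerset.1 hS h),
          Function.update_self]
      have hder : HasDerivAt (fun h : ℝ => ∑ S ∈ s.powerset,
          (-1 : ℝ) ^ S.card * (p (∑ i ∈ S, x i) - p (h + ∑ i ∈ S, x i)))
          (∑ S ∈ s.powerset, (-1 : ℝ) ^ S.card * -deriv p (0 + ∑ i ∈ S, x i)) 0 :=
        HasDerivAt.fun_sum fun S _ =>
          (((hd _).hasDerivAt.comp_add_const 0 (∑ i ∈ S, x i)).const_sub _).const_mul _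
      have h := hder.unique ((hasDerivAt_const (0 : ℝ) (0 : ℝ)).congr_of_eventuallyEq
        (Filter.Eventually.of_forall hconst))
      simpa using h
    obtain ⟨q, hq, hpq⟩ := ih hp' key
    obtain ⟨r, rfl, hr⟩ := Polynomial.exists_derivative_eq_of_degree_lt hq
    refine ⟨r + Polynomial.C (p 0 - r.eval 0), ?_, fun t => ?_⟩
    · rw [Finset.card_cons]
      refine (Polynomial.degree_add_le _ _).trans_lt (max_lt hr ?_)
      exact Polynomial.degree_C_le.trans_lt (by exact_mod_cast Nat.succ_pos _)
    · have h := is_const_of_deriv_eq_zero (f := fun t => p t - r.eval t)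
        (hd.sub r.differentiable)
        (fun t => by
          rw [deriv_fun_sub (hd t) r.differentiableAt, hpq, Polynomial.deriv, sub_self]) t 0
      simp only [Polynomial.eval_add, Polynomial.eval_C]
      linarith

/-- **Lemma (characterisation of polynomial functions).**
A smooth function `p : ℝ → ℝ` satisfies
`∑_{S ⊆ {0,…,n}} (−1)^{#S} p (∑_{i ∈ S} x_i) = 0`
for every collection of real numbers `x_0, …, x_n` if and only if `p` is
(the evaluation function of) a polynomial of degree at most `n`. -/
theorem smooth_alternating_sum_vanishes_iff_polynomial_of_degree_le
    (n : ℕ) (p : ℝ → ℝ) (hp : ContDiff ℝ (⊤ : ℕ∞) p) :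
    (∀ x : Fin (n + 1) → ℝ,
        ∑ S ∈ (Finset.univ : Finset (Fin (n + 1))).powerset,
          (-1 : ℝ) ^ S.card * p (∑ i ∈ S, x i) = 0) ↔
      ∃ q : Polynomial ℝ, q.degree ≤ (n : ℕ) ∧ ∀ t : ℝ, p t = q.eval t := by
  have hdeg (q : Polynomial ℝ) :
      q.degree ≤ (n : ℕ) ↔ q.degree < (Finset.univ : Finset (Fin (n + 1))).card := by
    rw [Finset.card_fin, Polynomial.degree_lt_iff_coeff_zero, Polynomial.degree_le_iff_coeff_zero]
    simp
  simp only [hdeg]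
  constructor
  · exact exists_polynomial_of_alternating_sum_powerset_eq_zero Finset.univ_nonempty hp
  · rintro ⟨q, hq, hpq⟩ x
    simpa only [hpq] using Polynomial.alternating_sum_powerset_eval_eq_zero _ x q hq
end

section
/- Let n ≥ 2 and k ≥ 0. For every point b ∈ ℝ³ ∖ Q_k, the fiber pr_{k,n}⁻¹(b), with its subspace topology, is homeomorphic to the configuration space Conf_{n−1}(ℝ³ ∖ Q_{k+1}). -/
noncomputable section

/-- `ℝ³` with the Euclidean metric. -/
abbrev R3 : Type := EuclideanSpace ℝ (Fin 3)

/-- The configuration space of `n` (ordered, distinct) points in the subset `A ⊆ ℝ³`,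
topologised as a subspace of `(ℝ³)^n`. -/
def Conf (n : ℕ) (A : Set R3) : Type :=
  {x : Fin n → R3 // Function.Injective x ∧ ∀ m, x m ∈ A}

instance (n : ℕ) (A : Set R3) : TopologicalSpace (Conf n A) :=
  instTopologicalSpaceSubtype

/-- The point `q_m = (4(m−1), 0, 0) ∈ ℝ³`. -/
def qpt (m : ℕ) : R3 := EuclideanSpace.single (0 : Fin 3) (4 * ((m : ℝ) - 1))

/-- The set `Q_k = {q_1, …, q_k} ⊆ ℝ³` (so `Q_0 = ∅`). -/
def Qset (k : ℕ) : Set R3 := qpt '' Set.Icc 1 k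

/-- The shear `v ↦ v + a v • w`, where `a` is invariant under translations along `w`. -/
def shear (a : R3 → ℝ) (w : R3) (ha : Continuous a) (hw : ∀ v (t : ℝ), a (v + t • w) = a v) :
    R3 ≃ₜ R3 where
  toFun v := v + a v • w
  invFun v := v - a v • w
  left_inv v := by simp [hw]
  right_inv v := by
    have h := hw v (-a v)
    rw [neg_smul, ← sub_eq_add_neg] at h
    simp [h]
  continuous_toFun := by fun_prop
  continuous_invFun := by fun_prop

lemma shear_apply (a : R3 → ℝ) (w : R3) (ha : Continuous a)
    (hw : ∀ v (t : ℝ), a (v + t • w) = a v) (v : R3) :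
    shear a w ha hw v = v + a v • w := rfl

lemma Qset_succ (k : ℕ) : Qset (k + 1) = insert (qpt (k + 1)) (Qset k) := by
  rw [Qset, Qset, ← Set.image_insert_eq]
  congr 1
  ext m
  simp only [Set.mem_Icc, Set.mem_insert_iff]
  omega

/-- A point off the first coordinate axis can be moved to `q_{k+1}` fixing `Q_k`. -/
lemma exists_homeomorph_of_off_axis (k : ℕ) (b : R3) (hb : b 1 ^ 2 + b 2 ^ 2 ≠ 0) :
    ∃ h : R3 ≃ₜ R3, (∀ q ∈ Qset k, h q = q) ∧ h b = qpt (k + 1) := by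
  let s₁ : R3 ≃ₜ R3 := shear (fun v => v 1 ^ 2 + v 2 ^ 2)
    (EuclideanSpace.single 0 ((4 * (k : ℝ) - b 0) / (b 1 ^ 2 + b 2 ^ 2)))
    (by fun_prop) (by intro v t; simp)
  have hs : s₁ b 0 = 4 * k := by
    simp only [s₁, shear_apply, PiLp.add_apply, PiLp.smul_apply, PiLp.single_apply, if_true,
      smul_eq_mul]
    field_simp
    ring
  let s₂ : R3 ≃ₜ R3 := shear (fun v => max 0 (v 0 - 4 * k + 1)) (qpt (k + 1) - s₁ b)
    (by fun_prop) (by intro v t; simp [hs, qpt])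
  refine ⟨s₁.trans s₂, ?_, ?_⟩
  · rintro _ ⟨m, hm, rfl⟩
    have h₁ : s₁ (qpt m) = qpt m := by simp [s₁, shear_apply, qpt]
    have hmk : (m : ℝ) ≤ k := by exact_mod_cast hm.2
    have h₂ : max 0 (qpt m 0 - 4 * k + 1) = 0 := by
      apply max_eq_left
      simp only [qpt, PiLp.single_apply, if_true]
      linarith
    simp only [Homeomorph.trans_apply, h₁]
    simp only [s₂, shear_apply, h₂, zero_smul, add_zero]
  · simp [s₂, shear_apply, hs]

/-- Every point outside `Q_k` can be moved to `q_{k+1}` fixing `Q_k`. -/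
lemma exists_homeomorph_qpt_succ (k : ℕ) (b : R3) (hb : b ∉ Qset k) :
    ∃ h : R3 ≃ₜ R3, (∀ q ∈ Qset k, h q = q) ∧ h b = qpt (k + 1) := by
  by_cases h0 : b 1 ^ 2 + b 2 ^ 2 = 0
  · have h1 : b 1 = 0 := by nlinarith [sq_nonneg (b 1), sq_nonneg (b 2)]
    have h2 : b 2 = 0 := by nlinarith [sq_nonneg (b 1), sq_nonneg (b 2)]
    let s : R3 ≃ₜ R3 := shear (fun v => ∏ m ∈ Finset.Icc 1 k, (v 0 - qpt m 0))
      (EuclideanSpace.single 1 1) (by fun_prop) (by intro v t; simp)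
    have hprod : ∏ m ∈ Finset.Icc 1 k, (b 0 - qpt m 0) ≠ 0 := by
      rw [Finset.prod_ne_zero_iff]
      intro m hm h
      refine hb ⟨m, by simpa using hm, ?_⟩
      ext i
      fin_cases i
      · exact (sub_eq_zero.mp h).symm
      · simp [qpt, h1]
      · simp [qpt, h2]
    have hsb : s b 1 ^ 2 + s b 2 ^ 2 ≠ 0 := by
      simpa [s, shear_apply, h1, h2] using hprod
    obtain ⟨h, hQ, hb'⟩ := exists_homeomorph_of_off_axis k (s b) hsb
    refine ⟨s.trans h, ?_, hb'⟩
    intro q hq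
    have hsq : s q = q := by
      obtain ⟨m, hm, rfl⟩ := hq
      have hz : ∏ l ∈ Finset.Icc 1 k, (qpt m 0 - qpt l 0) = 0 :=
        Finset.prod_eq_zero (Finset.mem_Icc.mpr hm) (sub_self _)
      simp only [s, shear_apply, hz, zero_smul, add_zero]
    rw [Homeomorph.trans_apply, hsq, hQ q hq]
  · exact exists_homeomorph_of_off_axis k b h0

/-- The fibre of the first-point projection over `b` is the configuration space of the
complement of `b`, transported along a homeomorphism `h` of `ℝ³`. -/
def Conf.fiberHomeomorph (n : ℕ) (A B : Set R3) (b : R3) (hb : b ∈ A) (h : R3 ≃ₜ R3)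
    (hB : ∀ v, h v ∈ B ↔ v ∈ A ∧ v ≠ b) :
    {y : Conf (n + 1) A // y.1 0 = b} ≃ₜ Conf n B where
  toFun y := ⟨fun i => h (y.1.1 i.succ),
    fun _ _ hij => Fin.succ_injective _ (y.1.2.1 (h.injective hij)),
    fun i => (hB _).2 ⟨y.1.2.2 _, fun hi =>
      Fin.succ_ne_zero i (y.1.2.1 (hi.trans y.2.symm))⟩⟩
  invFun x :=
    have hx : ∀ i, h.symm (x.1 i) ∈ A ∧ h.symm (x.1 i) ≠ b := fun i =>
      (hB _).1 (by simpa using x.2.2 i)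
    ⟨⟨Fin.cons b fun i => h.symm (x.1 i),
      Fin.cons_injective_iff.2 ⟨fun ⟨i, hi⟩ => (hx i).2 hi, h.symm.injective.comp x.2.1⟩,
      Fin.cases hb fun i => (hx i).1⟩, rfl⟩
  left_inv y := by
    refine Subtype.ext (Subtype.ext (funext (Fin.cases ?_ fun i => ?_)))
    · exact y.2.symm
    · simp
  right_inv x := by
    refine Subtype.ext (funext fun i => ?_)
    simp
  continuous_toFun := by
    refine Continuous.subtype_mk (continuous_pi fun i => h.continuous.comp ?_) _
    exact (continuous_apply _).comp (continuous_subtype_val.comp continuous_subtype_val)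
  continuous_invFun := by
    refine Continuous.subtype_mk (Continuous.subtype_mk
      (continuous_pi (Fin.cases continuous_const fun i => ?_)) _) _
    exact h.symm.continuous.comp ((continuous_apply i).comp continuous_subtype_val)

/-- **Fadell--Neuwirth, fibre identification.**  For `n ≥ 2`, `k ≥ 0` and any
`b ∈ ℝ³ ∖ Q_k`, the fibre of `pr_{k,n} : Conf_n(ℝ³ ∖ Q_k) → ℝ³ ∖ Q_k` over `b`
is homeomorphic to `Conf_{n−1}(ℝ³ ∖ Q_{k+1})`. -/
theorem fadellNeuwirth_fiber_homeo (n k : ℕ) (hn : 2 ≤ n)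
    (b : R3) (hb : b ∈ (Qset k)ᶜ) :
    Nonempty
      ({y : Conf n (Qset k)ᶜ // y.1 ⟨0, by omega⟩ = b} ≃ₜ
        Conf (n - 1) (Qset (k + 1))ᶜ) := by
  obtain ⟨m, rfl⟩ : ∃ m, n = m + 1 := ⟨n - 1, by omega⟩
  obtain ⟨h, hQ, hhb⟩ := exists_homeomorph_qpt_succ k b hb
  refine ⟨Conf.fiberHomeomorph m (Qset k)ᶜ (Qset (k + 1))ᶜ b hb h fun v => ?_⟩
  have hv : h v ∈ Qset k ↔ v ∈ Qset k :=
    ⟨fun hv => h.injective (hQ _ hv) ▸ hv, fun hv => (hQ v hv).symm ▸ hv⟩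
  rw [Qset_succ, Set.mem_compl_iff, Set.mem_insert_iff, hv, ← hhb, h.injective.eq_iff,
    Set.mem_compl_iff]
  tauto

end
end

section
/- Let n ≥ 2 and k ≥ 0. The map pr_{k,n} : Conf_n(ℝ³ ∖ Q_k) → ℝ³ ∖ Q_k is a locally trivial fiber bundle with fiber Conf_{n−1}(ℝ³ ∖ Q_{k+1}): for every b ∈ ℝ³ ∖ Q_k there exist an open neighborhood U of b in ℝ³ ∖ Q_k and a homeomorphism φ : pr_{k,n}⁻¹(U) → U × Conf_{n−1}(ℝ³ ∖ Q_{k+1}) such that for every y ∈ pr_{k,n}⁻¹(U) the first coordinate of φ(y) equals pr_{k,n}(y). -/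
noncomputable section

/-- The Fadell--Neuwirth projection `pr_{k,n}`, sending a configuration of `n` points in
`ℝ³ ∖ Q_k` to its first point. -/
def prMap (n k : ℕ) (hn : 0 < n) (y : Conf n (Qset k)ᶜ) : ((Qset k)ᶜ : Set R3) :=
  ⟨y.1 ⟨0, hn⟩, y.2.2 _⟩

section Tent

variable {E : Type*} [PseudoMetricSpace E]

/-- A tent function equal to `1` at `p` and vanishing outside the ball of radius `r`. -/
def tent (p : E) (r : ℝ) (x : E) : ℝ := max 0 (1 - dist x p / r)

lemma tent_self (p : E) (r : ℝ) : tent p r p = 1 := by simp [tent]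

lemma tent_eq_zero {p x : E} {r : ℝ} (hr : 0 < r) (hx : r ≤ dist x p) : tent p r x = 0 := by
  have : 1 ≤ dist x p / r := by rwa [le_div_iff₀ hr, one_mul]
  exact max_eq_left (by linarith)

lemma tent_nonneg (p : E) (r : ℝ) (x : E) : 0 ≤ tent p r x := le_max_left _ _

lemma tent_le_one (p x : E) {r : ℝ} (hr : 0 < r) : tent p r x ≤ 1 := by
  have : 0 ≤ dist x p / r := by positivity
  exact max_le zero_le_one (by linarith)

lemma abs_tent_sub_le (p x y : E) {r : ℝ} (hr : 0 < r) :
    |tent p r x - tent p r y| ≤ dist x y / r := by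
  have h1 := abs_max_sub_max_le_abs (1 - dist x p / r) (1 - dist y p / r) 0
  rw [max_comm _ (0 : ℝ), max_comm _ (0 : ℝ)] at h1
  refine h1.trans ?_
  have h2 : 1 - dist x p / r - (1 - dist y p / r) = (dist y p - dist x p) / r := by ring
  rw [h2, abs_div, abs_of_pos hr]
  gcongr
  rw [dist_comm x y]
  exact abs_dist_sub_le y x p

lemma continuous_tent (p : E) (r : ℝ) : Continuous (tent p r) := by
  unfold tent; fun_prop

end Tent

section LocalPush

open Metric

variable {E : Type*} [NormedAddCommGroup E] [NormedSpace ℝ E]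

lemma norm_tent_smul_sub_le (p x y v w : E) {r : ℝ} (hr : 0 < r) (hv : ‖v‖ ≤ r / 2) :
    ‖tent p r x • v - tent p r y • w‖ ≤ 1 / 2 * dist x y + dist v w := by
  have h : tent p r x • v - tent p r y • w
      = (tent p r x - tent p r y) • v + tent p r y • (v - w) := by module
  rw [h]
  refine (norm_add_le _ _).trans (add_le_add ?_ ?_)
  · rw [norm_smul, Real.norm_eq_abs]
    calc _ ≤ dist x y / r * (r / 2) := by
            gcongr
            exact abs_tent_sub_le p x y hr
      _ = _ := by field_simp
  · rw [norm_smul, Real.norm_eq_abs, abs_of_nonneg (tent_nonneg p r y), dist_eq_norm]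
    exact mul_le_of_le_one_left (norm_nonneg _) (tent_le_one p y hr)

/-- The map dragging `p` to `u`, supported in the ball of radius `r` around `p`. -/
def push (p : E) (r : ℝ) (u x : E) : E := x + tent p r x • (u - p)

lemma dist_le_push (p x y u w : E) {r : ℝ} (hr : 0 < r) (hu : dist u p ≤ r / 2) :
    dist x y ≤ 2 * (dist (push p r u x) (push p r w y) + dist u w) := by
  have h1 := norm_tent_smul_sub_le p x y (u - p) (w - p) hr (by rwa [← dist_eq_norm])
  rw [dist_sub_right] at h1
  have h2 : x - y = (push p r u x - push p r w y)
      - (tent p r x • (u - p) - tent p r y • (w - p)) := by unfold push; module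
  have h3 := norm_sub_le (push p r u x - push p r w y)
    (tent p r x • (u - p) - tent p r y • (w - p))
  rw [← h2, ← dist_eq_norm, ← dist_eq_norm] at h3
  linarith

lemma push_injective (p u : E) {r : ℝ} (hr : 0 < r) (hu : dist u p ≤ r / 2) :
    Function.Injective (push p r u) := by
  intro x y hxy
  have := dist_le_push p x y u u hr hu
  rw [hxy, dist_self, dist_self] at this
  exact dist_le_zero.1 (by linarith)

lemma push_surjective [CompleteSpace E] (p u : E) {r : ℝ} (hr : 0 < r) (hu : dist u p ≤ r / 2) :
    Function.Surjective (push p r u) := by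
  intro y
  have hc : ContractingWith (1 / 2) (fun x => y - tent p r x • (u - p)) := by
    refine ⟨by rw [div_lt_one] <;> norm_num, LipschitzWith.of_dist_le_mul fun a b => ?_⟩
    have h := norm_tent_smul_sub_le p a b (u - p) (u - p) hr (by rwa [← dist_eq_norm])
    rw [dist_self, add_zero] at h
    rw [dist_sub_left, dist_eq_norm]
    simpa using h
  refine ⟨hc.fixedPoint, ?_⟩
  have h : y - tent p r hc.fixedPoint • (u - p) = hc.fixedPoint := hc.fixedPoint_isFixedPt
  unfold push
  nth_rewrite 1 [← h]
  simp

lemma continuous_push (p : E) (r : ℝ) : Continuous fun q : E × E => push p r q.1 q.2 := by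
  have := continuous_tent p r
  unfold push
  fun_prop

/-- Near a point `p` outside a closed set `F`, the points `u` can be reached from `p` by a
continuous family of homeomorphisms fixing `F`. -/
theorem exists_homeomorph_family [CompleteSpace E] {F : Set E} (hF : IsClosed F) {p : E}
    (hp : p ∉ F) :
    ∃ s > 0, ∃ τ : ball p s → (E ≃ₜ E),
      (∀ u, τ u p = u) ∧ (∀ u, ∀ x ∈ F, τ u x = x) ∧
      (Continuous fun q : ball p s × E => τ q.1 q.2) ∧
      Continuous fun q : ball p s × E => (τ q.1).symm q.2 := by
  obtain ⟨r, hr, hrF⟩ := Metric.isOpen_iff.1 hF.isOpen_compl p hp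
  have hu (u : ball p (r / 2)) : dist (u : E) p ≤ r / 2 := (mem_ball.1 u.2).le
  let e (u : ball p (r / 2)) : E ≃ E := Equiv.ofBijective (push p r u)
    ⟨push_injective p u hr (hu u), push_surjective p u hr (hu u)⟩
  have he (u : ball p (r / 2)) (x : E) : push p r u ((e u).symm x) = x := (e u).apply_symm_apply x
  have hcont : Continuous fun q : ball p (r / 2) × E => e q.1 q.2 :=
    (continuous_push p r).comp (continuous_subtype_val.prodMap continuous_id)
  have hcont' : Continuous fun q : ball p (r / 2) × E => (e q.1).symm q.2 := by
    have hL : LipschitzWith 4 fun q : ball p (r / 2) × E => (e q.1).symm q.2 := by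
      refine LipschitzWith.of_dist_le_mul fun a b => ?_
      have h := dist_le_push p ((e a.1).symm a.2) ((e b.1).symm b.2) a.1 b.1 hr (hu _)
      rw [he, he] at h
      have h1 : dist (a.1 : E) b.1 ≤ dist a b := le_max_left (dist a.1 b.1) (dist a.2 b.2)
      have h2 : dist a.2 b.2 ≤ dist a b := le_max_right (dist a.1 b.1) (dist a.2 b.2)
      push_cast
      linarith
    exact hL.continuous
  refine ⟨r / 2, by positivity, fun u => ⟨e u, ?_, ?_⟩, fun u => ?_, fun u x hx => ?_,
    hcont, hcont'⟩
  · exact hcont.comp (Continuous.prodMk_right u)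
  · exact hcont'.comp (Continuous.prodMk_right u)
  · change p + tent p r p • ((u : E) - p) = u
    simp [tent_self]
  · have hx' : r ≤ dist x p := not_lt.1 fun h => hrF h hx
    change x + tent p r x • ((u : E) - p) = x
    simp [tent_eq_zero hr hx']

/-- Homeomorphisms fixing a closed set `F` act transitively on its complement, when that
complement is preconnected. -/
theorem exists_homeomorph_fixing [CompleteSpace E] {F : Set E} (hF : IsClosed F)
    (hconn : IsPreconnected Fᶜ) {p q : E} (hp : p ∉ F) (hq : q ∉ F) :
    ∃ h : E ≃ₜ E, h p = q ∧ ∀ x ∈ F, h x = x := by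
  let R (x y : E) : Prop := ∃ h : E ≃ₜ E, h x = y ∧ ∀ z ∈ F, h z = z
  refine hconn.induction₂ R (fun x hx => ?_) (fun x y z _ _ _ => ?_) (fun x y _ _ => ?_) hp hq
  · obtain ⟨s, hs, τ, h1, h2, -, -⟩ := exists_homeomorph_family hF hx
    filter_upwards [mem_nhdsWithin_of_mem_nhds (ball_mem_nhds x hs)] with y hy
    exact ⟨τ ⟨y, hy⟩, h1 _, h2 _⟩
  · rintro ⟨h, hxy, hh⟩ ⟨g, hyz, hg⟩
    exact ⟨h.trans g, by simp [hxy, hyz], fun w hw => by simp [hh w hw, hg w hw]⟩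
  · rintro ⟨h, hxy, hh⟩
    exact ⟨h.symm, by simp [← hxy], fun w hw => h.symm_apply_eq.2 (hh w hw).symm⟩

end LocalPush

lemma qpt_injective : Function.Injective qpt := by
  intro a b h
  have h0 := congrArg (fun x : R3 => x 0) h
  simpa [qpt] using h0

lemma finite_Qset (k : ℕ) : (Qset k).Finite := (Set.finite_Icc 1 k).image _

lemma qpt_succ_notMem_Qset (k : ℕ) : qpt (k + 1) ∉ Qset k := by
  rintro ⟨m, hm, h⟩
  have := qpt_injective h
  have := hm.2
  omega

lemma isPreconnected_Qset_compl (k : ℕ) : IsPreconnected (Qset k)ᶜ := by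
  refine ((finite_Qset k).countable.isConnected_compl_of_one_lt_rank ?_).isPreconnected
  rw [← Module.finrank_eq_rank, finrank_euclideanSpace_fin]
  norm_num

/-- A family of homeomorphisms of `ℝ³`, parametrised by a neighbourhood of `b`, carrying the
parameter to `q_{k+1}` and fixing `Q_k`. -/
lemma exists_straightening (k : ℕ) {b : R3} (hb : b ∉ Qset k) :
    ∃ s > 0, ∃ σ : Metric.ball b s → (R3 ≃ₜ R3),
      (∀ u x, σ u x ∈ Qset (k + 1) ↔ x = u ∨ x ∈ Qset k) ∧
      (Continuous fun q : Metric.ball b s × R3 => σ q.1 q.2) ∧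
      Continuous fun q : Metric.ball b s × R3 => (σ q.1).symm q.2 := by
  have hF := (finite_Qset k).isClosed
  obtain ⟨s, hs, τ, h1, h2, h3, h4⟩ := exists_homeomorph_family hF hb
  obtain ⟨g, hg, hgF⟩ := exists_homeomorph_fixing hF (isPreconnected_Qset_compl k) hb
    (qpt_succ_notMem_Qset k)
  have key (u x) (y) (hy : τ u (g.symm y) = y) : g ((τ u).symm x) = y ↔ x = y := by
    rw [← g.eq_symm_apply, Homeomorph.symm_apply_eq, hy]
  refine ⟨s, hs, fun u => (τ u).symm.trans g, fun u x => ?_, g.continuous.comp h4,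
    h3.comp (continuous_fst.prodMk (g.symm.continuous.comp continuous_snd))⟩
  have hfix (y) (hy : y ∈ Qset k) : g ((τ u).symm y) = y := by
    rw [(τ u).symm_apply_eq.2 (h2 u y hy).symm, hgF y hy]
  have hu : g ((τ u).symm u) = qpt (k + 1) := by
    rw [(τ u).symm_apply_eq.2 (h1 u).symm, hg]
  rw [Qset_succ, Set.mem_insert_iff]
  have hinj : Function.Injective fun x => g ((τ u).symm x) :=
    g.injective.comp (τ u).symm.injective
  refine or_congr ?_ ⟨fun h => ?_, fun h => ?_⟩
  · exact ⟨fun h => hinj (h.trans hu.symm), fun h => h ▸ hu⟩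
  · have : x = _ := hinj (hfix _ h).symm
    rw [this]; exact h
  · change g ((τ u).symm x) ∈ Qset k
    rwa [hfix x h]

lemma Conf.continuous_apply {n : ℕ} {A : Set R3} (i : Fin n) :
    Continuous fun y : Conf n A => y.1 i :=
  (_root_.continuous_apply i).comp continuous_subtype_val

lemma Conf.continuous_of_apply {X : Type*} [TopologicalSpace X] {n : ℕ} {A : Set R3}
    {f : X → Conf n A} (hf : ∀ i, Continuous fun x => (f x).1 i) : Continuous f :=
  continuous_induced_rng.2 (continuous_pi hf)

/-- The trivialisation of `prMap` given by a straightening family. -/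
def straighteningHomeomorph (m k : ℕ) (V : Set R3) (σ : V → (R3 ≃ₜ R3))
    (hσ : ∀ u x, σ u x ∈ Qset (k + 1) ↔ x = u ∨ x ∈ Qset k)
    (hc : Continuous fun q : V × R3 => σ q.1 q.2)
    (hc' : Continuous fun q : V × R3 => (σ q.1).symm q.2) :
    {y : Conf (m + 1) (Qset k)ᶜ // prMap (m + 1) k m.succ_pos y ∈
        ((↑) ⁻¹' V : Set ((Qset k)ᶜ : Set R3))} ≃ₜ
      (((↑) ⁻¹' V : Set ((Qset k)ᶜ : Set R3)) × Conf m (Qset (k + 1))ᶜ) where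
  toFun y := (⟨_, y.2⟩, ⟨fun i => σ ⟨y.1.1 0, y.2⟩ (y.1.1 i.succ),
    fun i j h => Fin.succ_injective _ (y.1.2.1 ((σ _).injective h)),
    fun i h => ((hσ _ _).1 h).elim
      (fun h => Fin.succ_ne_zero i (y.1.2.1 h)) (y.1.2.2 i.succ)⟩)
  invFun z := ⟨⟨Fin.cons z.1.1.1 fun i => (σ ⟨z.1.1.1, z.1.2⟩).symm (z.2.1 i),
    Fin.cons_injective_iff.2 ⟨by
      rintro ⟨i, hi⟩
      exact z.2.2.2 i (by simpa using (hσ ⟨z.1.1.1, z.1.2⟩ _).2 (Or.inl hi)),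
      (σ _).symm.injective.comp z.2.2.1⟩,
    Fin.cases z.1.1.2 fun i h => z.2.2.2 i (by
      simpa using (hσ ⟨z.1.1.1, z.1.2⟩ _).2 (Or.inr h))⟩, z.1.2⟩
  left_inv y := by
    refine Subtype.ext (Subtype.ext (funext (Fin.cases rfl fun i => ?_)))
    exact (σ _).symm_apply_apply _
  right_inv z := by
    refine Prod.ext rfl (Subtype.ext (funext fun i => ?_))
    exact (σ _).apply_symm_apply _
  continuous_toFun := by
    have h (i) : Continuous fun y : {y : Conf (m + 1) (Qset k)ᶜ //
        prMap (m + 1) k m.succ_pos y ∈ ((↑) ⁻¹' V : Set ((Qset k)ᶜ : Set R3))} => y.1.1 i :=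
      (Conf.continuous_apply i).comp continuous_subtype_val
    refine Continuous.prodMk (((h 0).subtype_mk _).subtype_mk _) ?_
    exact Conf.continuous_of_apply fun i => hc.comp (((h 0).subtype_mk _).prodMk (h i.succ))
  continuous_invFun := by
    have h : Continuous fun z : ((↑) ⁻¹' V : Set ((Qset k)ᶜ : Set R3)) ×
        Conf m (Qset (k + 1))ᶜ => z.1.1.1 :=
      continuous_subtype_val.comp (continuous_subtype_val.comp continuous_fst)
    refine Continuous.subtype_mk (Conf.continuous_of_apply (Fin.cases h fun i => ?_)) _
    exact hc'.comp ((h.subtype_mk _).prodMk ((Conf.continuous_apply i).comp continuous_snd))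

lemma straighteningHomeomorph_fst (m k : ℕ) (V : Set R3) (σ : V → (R3 ≃ₜ R3)) (hσ hc hc') (y) :
    ((straighteningHomeomorph m k V σ hσ hc hc' y).1 : ((Qset k)ᶜ : Set R3)) =
      prMap (m + 1) k m.succ_pos y.1 := rfl

/-- **Fadell--Neuwirth fibration, local triviality.**  For `n ≥ 2` and `k ≥ 0`, the map
`pr_{k,n} : Conf_n(ℝ³ ∖ Q_k) → ℝ³ ∖ Q_k` is a locally trivial fibre bundle with fibre
`Conf_{n−1}(ℝ³ ∖ Q_{k+1})`: every point of the base has an open neighbourhood `U`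
over which `pr_{k,n}` is trivialised. -/
theorem fadellNeuwirth_locally_trivial (n k : ℕ) (hn : 2 ≤ n)
    (b : ((Qset k)ᶜ : Set R3)) :
    ∃ U : Set ((Qset k)ᶜ : Set R3), IsOpen U ∧ b ∈ U ∧
      ∃ φ : {y : Conf n (Qset k)ᶜ // prMap n k (by omega) y ∈ U} ≃ₜ
          (U × Conf (n - 1) (Qset (k + 1))ᶜ),
        ∀ y, ((φ y).1 : ((Qset k)ᶜ : Set R3)) = prMap n k (by omega) y.1 := by
  obtain ⟨m, rfl⟩ : ∃ m, n = m + 1 := ⟨n - 1, by omega⟩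
  rw [Nat.add_sub_cancel]
  obtain ⟨s, hs, σ, hσ, hc, hc'⟩ := exists_straightening k b.2
  have hU : IsOpen ((↑) ⁻¹' Metric.ball (b : R3) s : Set ((Qset k)ᶜ : Set R3)) :=
    Metric.isOpen_ball.preimage continuous_subtype_val
  exact ⟨_, hU, Metric.mem_ball_self hs, straighteningHomeomorph m k _ σ hσ hc hc',
    straighteningHomeomorph_fst m k _ σ hσ hc hc'⟩

end
end

section
/- Let n ≥ 2 and k ≥ 0. The map pr_{k,n} : Conf_n(ℝ³ ∖ Q_k) → ℝ³ ∖ Q_k admits a continuous cross section: there exists a continuous map s : ℝ³ ∖ Q_k → Conf_n(ℝ³ ∖ Q_k) such that pr_{k,n} ∘ s is the identity of ℝ³ ∖ Q_k. -/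
noncomputable section

/-- A continuous radius function, positive off the closed set `C`, whose balls avoid `C`. -/
theorem exists_continuous_radius {X : Type*} [PseudoMetricSpace X] {C : Set X}
    (hC : IsClosed C) :
    ∃ r : X → ℝ, Continuous r ∧ (∀ b ∉ C, 0 < r b) ∧ ∀ b c, c ∈ C → r b ≤ dist b c := by
  rcases C.eq_empty_or_nonempty with rfl | hne
  · exact ⟨fun _ => 1, continuous_const, fun _ _ => one_pos, fun _ _ h => h.elim⟩
  · exact ⟨fun b => Metric.infDist b C, Metric.continuous_infDist_pt C,
      fun b hb => (hC.notMem_iff_infDist_pos hne).1 hb,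
      fun b c hc => Metric.infDist_le_dist_of_mem hc⟩

theorem isClosed_Qset (k : ℕ) : IsClosed (Qset k) :=
  ((Set.finite_Icc 1 k).image qpt).isClosed

/-- **Fadell--Neuwirth fibration, existence of a cross section.**  For `n ≥ 2` and
`k ≥ 0`, the map `pr_{k,n} : Conf_n(ℝ³ ∖ Q_k) → ℝ³ ∖ Q_k` admits a continuous
cross section. -/
theorem fadellNeuwirth_cross_section (n k : ℕ) (hn : 2 ≤ n) :
    ∃ s : ((Qset k)ᶜ : Set R3) → Conf n (Qset k)ᶜ,
      Continuous s ∧ ∀ b, prMap n k (by omega) (s b) = b := by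
  obtain ⟨r, hr, hpos, hle⟩ := exists_continuous_radius (isClosed_Qset k)
  set e : R3 := EuclideanSpace.single (0 : Fin 3) (1 : ℝ) with he
  have hnorm : ‖e‖ = 1 := by simp [he]
  have hn0 : (0 : ℝ) < n := by exact_mod_cast (by omega : 0 < n)
  have he0 : e ≠ 0 := norm_ne_zero_iff.1 (by simp [hnorm])
  refine ⟨fun b => ⟨fun j => b.1 + ((j : ℝ) / n * r b.1) • e, ?_, ?_⟩, ?_, ?_⟩
  · intro i j hij
    have h1 := smul_left_injective ℝ he0 (add_left_cancel hij)
    have h2 := mul_right_cancel₀ (hpos b.1 b.2).ne' h1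
    rw [div_left_inj' hn0.ne'] at h2
    exact Fin.ext (by exact_mod_cast h2)
  · intro j hmem
    have h1 := hle b.1 _ hmem
    have hb := hpos b.1 b.2
    have h0 : (0 : ℝ) ≤ (j : ℝ) / n := by positivity
    have hlt : (j : ℝ) / n < 1 := (div_lt_one hn0).2 (by exact_mod_cast j.2)
    rw [dist_self_add_right, norm_smul, hnorm, mul_one, Real.norm_eq_abs,
      abs_of_nonneg (mul_nonneg h0 hb.le)] at h1
    nlinarith
  · refine Continuous.subtype_mk (continuous_pi fun j => ?_) _
    fun_prop
  · intro b
    exact Subtype.ext (by simp [prMap])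

end
end

section
/- Let n ≥ 2 and i ≥ 1. For every choice of basepoints there is a group isomorphism π_i(Conf_n(ℝ³)) ≅ ∏_{k=0}^{n−1} π_i(ℝ³ ∖ Q_k). -/
open scoped Topology

noncomputable section

namespace FadellNeuwirth

open scoped unitInterval

section InducedMap

variable {N X Y Z : Type*} [TopologicalSpace X] [TopologicalSpace Y] [TopologicalSpace Z]

/-- Postcomposition of a generalized loop with a continuous map. -/
def genLoopMap (φ : C(X, Y)) {x : X} {y : Y} (h : φ x = y) (f : GenLoop N X x) :
    GenLoop N Y y :=
  ⟨φ.comp f.1, fun t ht => (congrArg φ (f.2 t ht)).trans h⟩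

variable [DecidableEq N] [Nonempty N]

/-- The homomorphism induced by a continuous map on homotopy groups. -/
def piMap (φ : C(X, Y)) {x : X} {y : Y} (h : φ x = y) :
    HomotopyGroup N X x →* HomotopyGroup N Y y :=
  MonoidHom.mk' (Quotient.map (genLoopMap φ h) fun _ _ H =>
    ContinuousMap.HomotopicRel.comp_continuousMap H φ) <| by
    rintro ⟨f⟩ ⟨g⟩
    have i : N := Classical.arbitrary N
    have key : genLoopMap φ h (GenLoop.transAt i g f) =
        GenLoop.transAt i (genLoopMap φ h g) (genLoopMap φ h f) := by
      ext t
      exact apply_ite φ _ _ _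
    refine (congrArg _ (HomotopyGroup.mul_spec (i := i) (p := f) (q := g))).trans ?_
    refine Eq.trans ?_ (HomotopyGroup.mul_spec (i := i)).symm
    exact congrArg _ key

theorem piMap_comp_apply (φ : C(X, Y)) (ψ : C(Y, Z)) {x : X} {y : Y} {z : Z} (h : φ x = y)
    (k : ψ y = z) (l : ψ.comp φ x = z) (a : HomotopyGroup N X x) :
    piMap ψ k (piMap φ h a) = piMap (ψ.comp φ) l a := by
  obtain ⟨f⟩ := a
  rfl

theorem piMap_eq_self (φ : C(X, X)) {x : X} (h : φ x = x) (hφ : ∀ z, φ z = z)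
    (a : HomotopyGroup N X x) : piMap φ h a = a := by
  obtain ⟨f⟩ := a
  exact congrArg (Quotient.mk _) (GenLoop.ext _ _ fun t => hφ _)

theorem piMap_const (φ : C(X, Y)) {x : X} {y : Y} (h : φ x = y) (hφ : ∀ z, φ z = y)
    (a : HomotopyGroup N X x) : piMap φ h a = 1 := by
  obtain ⟨f⟩ := a
  exact congrArg (Quotient.mk _) (GenLoop.ext _ _ fun t => hφ _)

/-- A homeomorphism induces isomorphisms of homotopy groups. -/
def piCongr (e : X ≃ₜ Y) {x : X} {y : Y} (h : e x = y) :
    HomotopyGroup N X x ≃* HomotopyGroup N Y y :=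
  MonoidHom.toMulEquiv (piMap (e : C(X, Y)) h)
    (piMap (e.symm : C(Y, X)) (by simp [← h]))
    (by
      ext a
      exact (piMap_comp_apply _ _ _ _ (by simp) a).trans (piMap_eq_self _ _ (by simp) a))
    (by
      ext a
      exact (piMap_comp_apply _ _ _ _ (by simp) a).trans
        (piMap_eq_self _ _ (by simp) a))

end InducedMap

section Splitting

/-- The homotopy lifting property with respect to compact spaces, with lifts that are stationary
wherever the given homotopy is stationary. -/
def HasRegularLifts {E B : Type*} [TopologicalSpace E] [TopologicalSpace B] (p : C(E, B)) : Prop :=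
  ∀ (A : Type) [TopologicalSpace A] [CompactSpace A] (H : C(I × A, B)) (g : C(A, E)),
    (∀ a, p (g a) = H (0, a)) → ∃ L : C(I × A, E), (∀ a, L (0, a) = g a) ∧
      (∀ x, p (L x) = H x) ∧ ∀ a, (∀ t, H (t, a) = H (0, a)) → ∀ t, L (t, a) = g a

variable {E B F : Type*} [TopologicalSpace E] [TopologicalSpace B] [TopologicalSpace F]
  {p : C(E, B)} {s : C(B, E)} {j : C(F, E)} {N : Type} [DecidableEq N] [Nonempty N]
  {b₀ : B} {e₀ : E} {f₀ : F}

/-- A map into the fibre, seen as a map to the total space, lifts to the fibre. -/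
theorem exists_fiber_factor (hj : Topology.IsEmbedding j) (hr : ∀ e, p e = b₀ → e ∈ Set.range j)
    {A : Type*} [TopologicalSpace A] (g : C(A, E)) (hg : ∀ a, p (g a) = b₀) :
    ∃ f : C(A, F), ∀ a, j (f a) = g a := by
  choose f hf using fun a => hr (g a) (hg a)
  refine ⟨⟨f, hj.continuous_iff.2 ?_⟩, hf⟩
  convert g.continuous
  exact funext hf

theorem piMap_fiber_surjective (hp : HasRegularLifts p) (hj : Topology.IsEmbedding j)
    (hr : ∀ e, p e = b₀ → e ∈ Set.range j) (hp₀ : p e₀ = b₀) (hj₀ : j f₀ = e₀)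
    (a : HomotopyGroup N E e₀) (ha : piMap p hp₀ a = 1) :
    ∃ f : HomotopyGroup N F f₀, piMap j hj₀ f = a := by
  obtain ⟨g⟩ := a
  obtain ⟨H⟩ : GenLoop.Homotopic (genLoopMap p hp₀ g) GenLoop.const := Quotient.exact ha
  have hb : ∀ t, ∀ x ∈ Cube.boundary N, H (t, x) = b₀ := fun t x hx =>
    (H.eq_snd t hx).trans rfl
  obtain ⟨L, hL0, hLp, hLc⟩ := hp _ H.toContinuousMap g.1 fun a => (H.apply_zero a).symm
  have hLb : ∀ t, ∀ x ∈ Cube.boundary N, L (t, x) = e₀ := fun t x hx =>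
    (hLc x (fun t' => (hb t' x hx).trans (hb 0 x hx).symm) t).trans (g.2 x hx)
  obtain ⟨f, hf⟩ := exists_fiber_factor hj hr (L.comp (.prodMk (.const _ 1) (.id _)))
    fun a => (hLp _).trans (H.apply_one a)
  refine ⟨⟦⟨f, fun x hx => hj.injective ?_⟩⟧, ?_⟩
  · exact (hf x).trans ((hLb 1 x hx).trans hj₀.symm)
  · refine Quotient.sound (Setoid.symm ?_)
    refine ⟨⟨⟨L, hL0, fun x => (hf x).symm⟩, fun t x hx => ?_⟩⟩
    exact (hLb t x hx).trans (g.2 x hx).symm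

theorem piMap_fiber_injective (hp : HasRegularLifts p) (hj : Topology.IsEmbedding j)
    (hr : ∀ e, p e = b₀ → e ∈ Set.range j) (hjp : ∀ f, p (j f) = b₀) (hs : ∀ b, p (s b) = b)
    (hs₀ : s b₀ = e₀) (hj₀ : j f₀ = e₀) :
    Function.Injective (piMap (N := N) j hj₀) := by
  refine (injective_iff_map_eq_one _).2 ?_
  rintro ⟨f⟩ ha
  obtain ⟨H⟩ : GenLoop.Homotopic (genLoopMap j hj₀ f) GenLoop.const := Quotient.exact ha
  have hb : ∀ t, ∀ x ∈ Cube.boundary N, H (t, x) = e₀ := fun t x hx =>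
    (H.eq_snd t hx).trans rfl
  have H0 : ∀ x, H (0, x) = j (f x) := fun x => H.apply_zero x
  have H1 : ∀ x, H (1, x) = e₀ := fun x => H.apply_one x
  let φ : C(ℝ, I) := ⟨Set.projIcc 0 1 zero_le_one, continuous_projIcc⟩
  have φ0 : φ 0 = 0 := Set.projIcc_left zero_le_one
  have φ1 : φ 1 = 1 := Set.projIcc_right zero_le_one
  -- first follow `H`, then run back along the section
  let J : C(I × (N → I), E) :=
    ⟨fun z => if (z.1 : ℝ) ≤ 1 / 2 then H (φ (2 * z.1), z.2) else
      s (p (H (φ (2 - 2 * z.1), z.2))), by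
      refine Continuous.if_le (by fun_prop) (by fun_prop) (by fun_prop) (by fun_prop) ?_
      intro z hz
      rw [hz]
      norm_num
      rw [φ1, H1, ← hs₀, hs]⟩
  let K : C(I × (I × (N → I)), B) :=
    ⟨fun z => p (H (φ ((1 - z.1) * (if (z.2.1 : ℝ) ≤ 1 / 2 then
      2 * (z.2.1 : ℝ) else 2 - 2 * (z.2.1 : ℝ))), z.2.2)), by
      have : Continuous fun z : I × (I × (N → I)) =>
          (if (z.2.1 : ℝ) ≤ 1 / 2 then 2 * (z.2.1 : ℝ) else 2 - 2 * z.2.1) := by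
        refine Continuous.if_le (by fun_prop) (by fun_prop) (by fun_prop) (by fun_prop) ?_
        intro z hz
        rw [hz]
        norm_num
      fun_prop⟩
  have hJ0 : ∀ x, J (0, x) = j (f x) := fun x => by
    simp [J, φ0, H0]
  have hJ1 : ∀ x, J (1, x) = e₀ := fun x => by
    have : ¬ (1 : ℝ) ≤ 1 / 2 := by norm_num
    simp only [J, ContinuousMap.coe_mk, Set.Icc.coe_one, this, if_false]
    norm_num [φ0, H0, hjp, hs₀]
  have hJb : ∀ t, ∀ x ∈ Cube.boundary N, J (t, x) = e₀ := fun t x hx => by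
    have hpe : p e₀ = b₀ := by rw [← hs₀, hs]
    simp only [J, ContinuousMap.coe_mk, hb _ x hx, hpe, hs₀, ite_self]
  obtain ⟨L, hL0, hLp, hLc⟩ := hp _ K J fun z => by
    simp only [J, K, ContinuousMap.coe_mk, Set.Icc.coe_zero, sub_zero, one_mul]
    split_ifs
    · rfl
    · rw [hs]
  have hK0 : ∀ t x, K (t, 0, x) = b₀ := fun t x => by
    simp [K, φ0, H0, hjp]
  have hK1 : ∀ t x, K (t, 1, x) = b₀ := fun t x => by
    have : ¬ (1 : ℝ) ≤ 1 / 2 := by norm_num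
    simp only [K, ContinuousMap.coe_mk, Set.Icc.coe_one, this, if_false]
    norm_num [φ0, H0, hjp]
  have hKb : ∀ t u, ∀ x ∈ Cube.boundary N, K (t, u, x) = p e₀ := fun t u x hx => by
    simp only [K, ContinuousMap.coe_mk, hb _ x hx]
  obtain ⟨h, hh⟩ := exists_fiber_factor hj hr (L.comp (.prodMk (.const _ 1) (.id _)))
    fun z => (hLp _).trans (by simp [K, φ0, H0, hjp])
  have hh' : ∀ z, j (h z) = L (1, z) := hh
  refine Quotient.sound ⟨⟨⟨h, fun x => hj.injective ?_, fun x => hj.injective ?_⟩,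
    fun t x hx => hj.injective ?_⟩⟩
  · exact (hh' _).trans ((hLc (0, x) (fun t => by rw [hK0, hK0]) 1).trans (hJ0 x))
  · exact (hh' _).trans ((hLc (1, x) (fun t => by rw [hK1, hK1]) 1).trans
      ((hJ1 x).trans hj₀.symm))
  · exact (hh' _).trans ((hLc (t, x) (fun u => by rw [hKb _ _ x hx, hKb _ _ x hx]) 1).trans
      ((hJb t x hx).trans (hj₀.symm.trans (congrArg j (f.2 x hx).symm))))

theorem piMap_section_mul_surjective (hp : HasRegularLifts p) (hj : Topology.IsEmbedding j)
    (hr : ∀ e, p e = b₀ → e ∈ Set.range j) (hs : ∀ b, p (s b) = b)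
    (hs₀ : s b₀ = e₀) (hj₀ : j f₀ = e₀) (a : HomotopyGroup N E e₀) :
    ∃ (f : HomotopyGroup N F f₀) (b : HomotopyGroup N B b₀),
      piMap j hj₀ f * piMap s hs₀ b = a := by
  have hp₀ : p e₀ = b₀ := by rw [← hs₀, hs]
  have hps : ∀ b : HomotopyGroup N B b₀, piMap p hp₀ (piMap s hs₀ b) = b := fun b =>
    (piMap_comp_apply _ _ _ _ (hs b₀) b).trans (piMap_eq_self _ _ hs b)
  obtain ⟨f, hf⟩ := piMap_fiber_surjective hp hj hr hp₀ hj₀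
    (a * (piMap s hs₀ (piMap p hp₀ a))⁻¹) (by rw [map_mul, map_inv, hps, mul_inv_cancel])
  exact ⟨f, piMap p hp₀ a, by rw [hf, inv_mul_cancel_right]⟩

/-- A fibration with a section splits on commutative homotopy groups. -/
theorem nonempty_mulEquiv_prod (hp : HasRegularLifts p) (hj : Topology.IsEmbedding j)
    (hr : ∀ e, p e = b₀ → e ∈ Set.range j) (hjp : ∀ f, p (j f) = b₀) (hs : ∀ b, p (s b) = b)
    (hs₀ : s b₀ = e₀) (hj₀ : j f₀ = e₀) (hc : ∀ a b : HomotopyGroup N E e₀, a * b = b * a) :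
    Nonempty (HomotopyGroup N E e₀ ≃* HomotopyGroup N B b₀ × HomotopyGroup N F f₀) := by
  have hp₀ : p e₀ = b₀ := by rw [← hs₀, hs]
  let Φ : HomotopyGroup N B b₀ × HomotopyGroup N F f₀ →* HomotopyGroup N E e₀ :=
    MonoidHom.mk' (fun z => piMap j hj₀ z.2 * piMap s hs₀ z.1) fun z w => by
      simp only [Prod.fst_mul, Prod.snd_mul, map_mul, mul_assoc]
      congr 1
      simp only [← mul_assoc]
      congr 1
      exact hc _ _
  refine ⟨(MulEquiv.ofBijective Φ ⟨(injective_iff_map_eq_one _).2 ?_, fun a => ?_⟩).symm⟩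
  · rintro ⟨b, f⟩ (h : piMap j hj₀ f * piMap s hs₀ b = 1)
    have hb := congrArg (piMap p hp₀) h
    rw [map_mul, map_one, piMap_comp_apply j p _ _ ((congrArg p hj₀).trans hp₀),
      piMap_const _ _ hjp, one_mul, piMap_comp_apply s p _ _ (hs b₀), piMap_eq_self _ _ hs] at hb
    subst hb
    rw [map_one, mul_one] at h
    rw [piMap_fiber_injective hp hj hr hjp hs hs₀ hj₀ (h.trans (map_one _).symm)]
    rfl
  · obtain ⟨f, b, h⟩ := piMap_section_mul_surjective hp hj hr hs hs₀ hj₀ a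
    exact ⟨(b, f), h⟩

end Splitting

section Push

variable {n : ℕ}

/-- A tent function of radius `r` around the origin. -/
def tent (r : ℝ) (w : R3) : ℝ := max 0 (1 - ‖w‖ / r)

/-- The displacement of `ℝ³` that moves `x m` to `y m` and is supported near the points `x m`. -/
def push (r : ℝ) (x y : Fin n → R3) (z : R3) : R3 := z + ∑ m, tent r (z - x m) • (y m - x m)

theorem abs_tent_sub_le {r : ℝ} (hr : 0 < r) (v w : R3) :
    |tent r v - tent r w| ≤ ‖v - w‖ / r := by
  have key := abs_max_sub_max_le_max 0 (1 - ‖v‖ / r) 0 (1 - ‖w‖ / r)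
  rw [sub_self, abs_zero, max_eq_right (abs_nonneg (1 - ‖v‖ / r - (1 - ‖w‖ / r)))] at key
  refine key.trans ?_
  rw [sub_sub_sub_cancel_left, ← sub_div, abs_div, abs_of_pos hr, abs_sub_comm]
  gcongr
  exact abs_norm_sub_norm_le v w

theorem tent_of_le {r : ℝ} (hr : 0 < r) {w : R3} (hw : r ≤ ‖w‖) : tent r w = 0 := by
  have : 1 ≤ ‖w‖ / r := (one_le_div hr).2 hw
  exact max_eq_left (by linarith)

theorem push_self (r : ℝ) (x : Fin n → R3) (z : R3) : push r x x z = z := by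
  simp [push]

theorem push_apply {r : ℝ} (hr : 0 < r) {x : Fin n → R3}
    (hx : ∀ l m, l ≠ m → r ≤ ‖x l - x m‖) (y : Fin n → R3) (m : Fin n) :
    push r x y (x m) = y m := by
  rw [push, Finset.sum_eq_single m]
  · simp [tent]
  · intro l _ hl
    rw [tent_of_le hr (hx m l hl.symm), zero_smul]
  · simp

theorem norm_push_sub_sub_le {r : ℝ} (hr : 0 < r) (x y : Fin n → R3) (z w : R3) :
    ‖push r x y z - push r x y w - (z - w)‖ ≤ (∑ m, ‖y m - x m‖) / r * ‖z - w‖ := by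
  have : push r x y z - push r x y w - (z - w) =
      ∑ m, (tent r (z - x m) - tent r (w - x m)) • (y m - x m) := by
    simp only [push, sub_smul, Finset.sum_sub_distrib]
    abel
  rw [this, div_mul_eq_mul_div, mul_comm, mul_div_right_comm, Finset.mul_sum]
  refine norm_sum_le_of_le _ fun m _ => ?_
  rw [norm_smul, Real.norm_eq_abs]
  gcongr
  simpa using abs_tent_sub_le hr (z - x m) (w - x m)

theorem push_ne {r : ℝ} (hr : 0 < r) {x y : Fin n → R3}
    (hx : ∀ l m, l ≠ m → r ≤ ‖x l - x m‖) (hxy : ∑ m, ‖y m - x m‖ < r) {z : R3}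
    (hz : ∀ m, z ≠ x m) (m : Fin n) : push r x y z ≠ y m := by
  intro h
  have key := norm_push_sub_sub_le hr x y z (x m)
  rw [push_apply hr hx, h, sub_self, zero_sub, norm_neg] at key
  have hpos : 0 < ‖z - x m‖ := norm_pos_iff.2 (sub_ne_zero.2 (hz m))
  have : (∑ m, ‖y m - x m‖) / r < 1 := (div_lt_one hr).2 hxy
  nlinarith

theorem continuous_push (r : ℝ) :
    Continuous fun u : (Fin n → R3) × (Fin n → R3) × R3 => push r u.1 u.2.1 u.2.2 := by
  unfold push tent
  fun_prop

end Push

section Transitivity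

theorem nonempty_homeomorph_of_near {Y : Set R3} (hY : Y.Finite) {z : R3} (hz : z ∉ Y) :
    ∃ ε > 0, ∀ w, ‖w - z‖ < ε → ∃ h : R3 ≃ₜ R3, h z = w ∧ ∀ y ∈ Y, h y = y := by
  obtain ⟨r, hr, hball⟩ := Metric.isOpen_iff.1 hY.isClosed.isOpen_compl z hz
  refine ⟨r, hr, fun w hw => ?_⟩
  have hc : ApproximatesLinearOn (push r (fun _ : Fin 1 => z) fun _ => w)
      (ContinuousLinearEquiv.refl ℝ R3 : R3 →L[ℝ] R3) Set.univ (‖w - z‖₊ / r.toNNReal) := by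
    intro a _ b _
    have := norm_push_sub_sub_le hr (fun _ : Fin 1 => z) (fun _ => w) a b
    simpa [hr.le] using this
  have hlt : ‖w - z‖₊ / r.toNNReal <
      ‖((ContinuousLinearEquiv.refl ℝ R3).symm : R3 →L[ℝ] R3)‖₊⁻¹ := by
    have h1 : ‖((ContinuousLinearEquiv.refl ℝ R3).symm : R3 →L[ℝ] R3)‖₊ = 1 :=
      ContinuousLinearMap.nnnorm_id
    rw [h1, inv_one, ← NNReal.coe_lt_coe]
    simpa [hr.le] using (div_lt_one hr).2 hw
  refine ⟨hc.toHomeomorph _ (.inr hlt), ?_, fun y hy => ?_⟩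
  · exact push_apply hr (x := fun _ : Fin 1 => z)
      (fun l m h => (h (Subsingleton.elim _ _)).elim) (fun _ => w) 0
  · have : r ≤ ‖y - z‖ := by
      by_contra! hlt'
      exact hball (by simpa [dist_eq_norm] using hlt') hy
    change push r (fun _ : Fin 1 => z) (fun _ => w) y = y
    simp [push, tent_of_le hr this]

theorem isPreconnected_compl {Y : Set R3} (hY : Y.Finite) : IsPreconnected Yᶜ := by
  refine (hY.countable.isConnected_compl_of_one_lt_rank ?_).isPreconnected
  rw [← Module.finrank_eq_rank, finrank_euclideanSpace_fin]
  norm_num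

theorem exists_homeomorph_fixing {Y : Set R3} (hY : Y.Finite) {z w : R3} (hz : z ∉ Y)
    (hw : w ∉ Y) : ∃ h : R3 ≃ₜ R3, h z = w ∧ ∀ y ∈ Y, h y = y := by
  refine (isPreconnected_compl hY).induction₂ (P := fun z w => ∃ h : R3 ≃ₜ R3, h z = w ∧
    ∀ y ∈ Y, h y = y) ?_ ?_ ?_ hz hw
  · intro z hz
    obtain ⟨ε, hε, H⟩ := nonempty_homeomorph_of_near hY hz
    refine mem_nhdsWithin_of_mem_nhds (Filter.mem_of_superset (Metric.ball_mem_nhds z hε) ?_)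
    intro w hw
    exact H w (by simpa [dist_eq_norm] using hw)
  · rintro a b c - - - ⟨h, rfl, h'⟩ ⟨k, rfl, k'⟩
    exact ⟨h.trans k, rfl, fun y hy => by simp [h' y hy, k' y hy]⟩
  · rintro a b - - ⟨h, rfl, h'⟩
    exact ⟨h.symm, by simp, fun y hy => h.symm_apply_eq.2 (h' y hy).symm⟩

theorem exists_homeomorph_apply_eq {n : ℕ} {x y : Fin n → R3} (hx : Function.Injective x)
    (hy : Function.Injective y) : ∃ h : R3 ≃ₜ R3, ∀ m, h (x m) = y m := by
  induction n with
  | zero => exact ⟨.refl _, fun m => m.elim0⟩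
  | succ n ih =>
    obtain ⟨h, hh⟩ := ih (hx.comp (Fin.castSucc_injective n)) (hy.comp (Fin.castSucc_injective n))
    simp only [Function.comp_apply] at hh
    obtain ⟨k, hk, hk'⟩ := exists_homeomorph_fixing
      (Set.finite_range fun m : Fin n => y m.castSucc)
      (z := h (x (Fin.last n))) (w := y (Fin.last n))
      (by
        rintro ⟨m, hm⟩
        replace hm := (hh m).trans hm
        exact (Fin.castSucc_lt_last m).ne (hx (h.injective hm)))
      (by
        rintro ⟨m, hm⟩
        exact (Fin.castSucc_lt_last m).ne (hy hm))
    refine ⟨h.trans k, Fin.lastCases hk fun m => ?_⟩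
    rw [Homeomorph.trans_apply, hh]
    exact hk' _ ⟨m, rfl⟩

end Transitivity

section Lifting

variable {n : ℕ}

theorem continuous_conf_val (A : Set R3) : Continuous fun c : Conf n A => c.1 :=
  continuous_subtype_val

/-- Forgetting the last point of a configuration. -/
def confInit (n : ℕ) : C(Conf (n + 1) (Set.univ : Set R3), Conf n (Set.univ : Set R3)) where
  toFun c := ⟨fun m => c.1 m.castSucc, c.2.1.comp (Fin.castSucc_injective n), fun _ => trivial⟩
  continuous_toFun := by
    exact Continuous.subtype_mk (continuous_pi fun m : Fin n =>
      (continuous_apply m.castSucc).comp (continuous_conf_val _)) _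

/-- Adding a point to a configuration. -/
def confSnoc (c : Conf n (Set.univ : Set R3)) (z : R3) (hz : ∀ m, z ≠ c.1 m) :
    Conf (n + 1) (Set.univ : Set R3) :=
  ⟨Fin.snoc c.1 z, Fin.snoc_injective_of_injective c.2.1 fun ⟨m, hm⟩ => hz m hm.symm,
    fun _ => trivial⟩

theorem confInit_confSnoc (c : Conf n (Set.univ : Set R3)) (z : R3) (hz : ∀ m, z ≠ c.1 m) :
    confInit n (confSnoc c z hz) = c :=
  Subtype.ext <| funext fun m => Fin.snoc_castSucc (α := fun _ => R3) z c.1 m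

theorem confSnoc_val_last (c : Conf n (Set.univ : Set R3)) (z : R3) (hz : ∀ m, z ≠ c.1 m) :
    (confSnoc c z hz).1 (Fin.last n) = z :=
  Fin.snoc_last (α := fun _ => R3) z c.1

theorem conf_ext_last {c d : Conf (n + 1) (Set.univ : Set R3)}
    (h : confInit n c = confInit n d) (h' : c.1 (Fin.last n) = d.1 (Fin.last n)) : c = d :=
  Subtype.ext <| funext <| Fin.lastCases h' fun m => congrFun (congrArg Subtype.val h) m

theorem continuous_confSnoc {X : Type*} [TopologicalSpace X]
    {f : X → Conf n (Set.univ : Set R3)} {g : X → R3} (hf : Continuous f) (hg : Continuous g)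
    (hz : ∀ x m, g x ≠ (f x).1 m) : Continuous fun x => confSnoc (f x) (g x) (hz x) :=
  Continuous.subtype_mk
    (Continuous.finSnoc (A := fun _ => R3) ((continuous_conf_val _).comp hf) hg) _

theorem exists_separation {X : Type*} [TopologicalSpace X] [CompactSpace X]
    (H : C(X, Conf n (Set.univ : Set R3))) :
    ∃ r > 0, ∀ x l m, l ≠ m → r ≤ ‖(H x).1 l - (H x).1 m‖ := by
  have hH : Continuous fun x => (H x).1 := (continuous_conf_val _).comp H.continuous
  have : ∀ᶠ r : ℝ in 𝓝[>] 0, ∀ l m, l ≠ m → ∀ x, r ≤ ‖(H x).1 l - (H x).1 m‖ := by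
    refine Filter.eventually_all.2 fun l => Filter.eventually_all.2 fun m => ?_
    by_cases hlm : l = m
    · simp [hlm]
    · obtain ⟨r, hr, hle⟩ := isCompact_univ.exists_forall_le'
        (f := fun x => ‖(H x).1 l - (H x).1 m‖) (a := 0)
        (((continuous_apply l).comp hH).sub ((continuous_apply m).comp hH)).norm.continuousOn
        fun x _ => norm_pos_iff.2 (sub_ne_zero.2 fun h => hlm ((H x).2.1 h))
      filter_upwards [Ioc_mem_nhdsGT hr] with s hs _ x
      exact hs.2.trans (hle x trivial)
  obtain ⟨r, hr, h0⟩ := (this.and self_mem_nhdsWithin).exists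
  exact ⟨r, h0, fun x l m h => hr l m h x⟩

theorem exists_small_variation {A : Type*} [TopologicalSpace A] [CompactSpace A]
    (H : C(I × A, Conf n (Set.univ : Set R3))) {r : ℝ} (hr : 0 < r) :
    ∃ δ > 0, ∀ s t : I, dist s t < δ → ∀ a, ∑ m, ‖(H (t, a)).1 m - (H (s, a)).1 m‖ < r := by
  let G : C(I × A, Fin n → R3) :=
    ⟨fun x => (H x).1, (continuous_conf_val _).comp H.continuous⟩
  have hu := CompactSpace.uniformContinuous_of_continuous G.curry.continuous
  have hr' : 0 < r / (n + 1) := by positivity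
  obtain ⟨δ, hδ, h⟩ := Metric.uniformContinuous_iff.1 hu (r / (n + 1)) hr'
  refine ⟨δ, hδ, fun s t hst a => ?_⟩
  have hm : ∀ m, ‖(H (t, a)).1 m - (H (s, a)).1 m‖ ≤ r / (n + 1) := fun m => by
    rw [← dist_eq_norm, dist_comm]
    exact (dist_le_pi_dist (G (s, a)) (G (t, a)) m).trans
      ((ContinuousMap.dist_apply_le_dist (f := G.curry s) (g := G.curry t) a).trans (h hst).le)
  calc ∑ m, ‖(H (t, a)).1 m - (H (s, a)).1 m‖ ≤ ∑ _m : Fin n, r / (n + 1) :=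
        Finset.sum_le_sum fun m _ => hm m
    _ = n * (r / (n + 1)) := by simp
    _ < (n + 1) * (r / (n + 1)) := by gcongr; linarith
    _ = r := by field_simp

theorem hasRegularLifts_confInit (n : ℕ) : HasRegularLifts (confInit n) := by
  intro A _ _ H g hg
  obtain ⟨r, hr, hsep⟩ := exists_separation H
  obtain ⟨δ, hδ, hvar⟩ := exists_small_variation H hr
  obtain ⟨M, hM⟩ := exists_nat_one_div_lt hδ
  let τ : ℕ → I → I := fun j t => ⟨min t (j / (M + 1)),
    le_min t.2.1 (by positivity), (min_le_left _ _).trans t.2.2⟩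
  have τc : ∀ j, Continuous (τ j) := fun j => by fun_prop
  have τ0 : ∀ t, τ 0 t = 0 := fun t => Subtype.ext (by simpa [τ] using t.2.1)
  have τz : ∀ j, τ j 0 = 0 := fun j => Subtype.ext (by
    have : (0 : ℝ) ≤ j / (M + 1) := by positivity
    simpa [τ] using this)
  have τ1 : ∀ t, τ (M + 1) t = t := fun t => Subtype.ext (by
    have : ((M + 1 : ℕ) : ℝ) / (M + 1) = 1 := by push_cast; field_simp
    simp only [τ, this]
    exact min_eq_left t.2.2)
  have τd : ∀ j t, dist (τ j t) (τ (j + 1) t) < δ := fun j t => by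
    refine lt_of_le_of_lt ?_ hM
    rw [Subtype.dist_eq, Real.dist_eq]
    refine (abs_min_sub_min_le_max _ _ _ _).trans (max_le (by simp; positivity) ?_)
    push_cast
    rw [← sub_div, abs_div, abs_of_pos (by positivity : (0 : ℝ) < M + 1)]
    gcongr
    simp
  have step : ∀ j, ∃ z : C(I × A, R3), (∀ a, z (0, a) = (g a).1 (Fin.last n)) ∧
      (∀ t a m, z (t, a) ≠ (H (τ j t, a)).1 m) ∧
      ∀ a, (∀ t, H (t, a) = H (0, a)) → ∀ t, z (t, a) = (g a).1 (Fin.last n) := by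
    intro j
    induction j with
    | zero =>
      refine ⟨⟨fun x => (g x.2).1 (Fin.last n), ?_⟩, fun _ => rfl, fun t a m h => ?_,
        fun _ _ _ => rfl⟩
      · have := (continuous_conf_val (n := n + 1) Set.univ).comp g.continuous
        exact (continuous_apply (Fin.last n)).comp (this.comp continuous_snd)
      · rw [τ0, ← hg] at h
        exact (Fin.castSucc_lt_last m).ne' ((g a).2.1 h)
    | succ j ih =>
      obtain ⟨z, hz0, hz, hzc⟩ := ih
      refine ⟨⟨fun x => push r (H (τ j x.1, x.2)).1 (H (τ (j + 1) x.1, x.2)).1 (z x), ?_⟩,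
        fun a => ?_, fun t a => ?_, fun a ha t => ?_⟩
      · have h1 : ∀ j, Continuous fun x : I × A => (H (τ j x.1, x.2)).1 := fun j =>
          (continuous_conf_val Set.univ).comp (H.continuous.comp
            (((τc j).comp continuous_fst).prodMk continuous_snd))
        exact (continuous_push r).comp ((h1 j).prodMk ((h1 (j + 1)).prodMk z.continuous))
      · change push r (H (τ j 0, a)).1 (H (τ (j + 1) 0, a)).1 (z (0, a)) = _
        rw [τz, τz, push_self, hz0]
      · exact push_ne hr (hsep _) (hvar _ _ (τd j t) a) (hz t a)
      · change push r (H (τ j t, a)).1 (H (τ (j + 1) t, a)).1 (z (t, a)) = _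
        rw [ha, ha (τ (j + 1) t), push_self, hzc a ha]
  obtain ⟨z, hz0, hz, hzc⟩ := step (M + 1)
  simp only [τ1] at hz
  refine ⟨⟨fun x => confSnoc (H x) (z x) (hz x.1 x.2),
    continuous_confSnoc H.continuous z.continuous _⟩, fun a => ?_, fun x => ?_, fun a ha t => ?_⟩
  · exact conf_ext_last ((confInit_confSnoc (H (0, a)) (z (0, a)) (hz 0 a)).trans (hg a).symm)
      ((confSnoc_val_last (H (0, a)) (z (0, a)) (hz 0 a)).trans (hz0 a))
  · exact confInit_confSnoc (H x) (z x) (hz x.1 x.2)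
  · exact conf_ext_last
      ((confInit_confSnoc (H (t, a)) (z (t, a)) (hz t a)).trans ((ha t).trans (hg a).symm))
      ((confSnoc_val_last (H (t, a)) (z (t, a)) (hz t a)).trans (hzc a ha t))

/-- A point away from all points of a configuration. -/
def farPoint (c : Conf n (Set.univ : Set R3)) : R3 :=
  (1 + ∑ m, ‖c.1 m‖) • EuclideanSpace.single 0 1

theorem farPoint_ne (c : Conf n (Set.univ : Set R3)) (m : Fin n) : farPoint c ≠ c.1 m := by
  intro h
  have h1 : ‖farPoint c‖ = 1 + ∑ m, ‖c.1 m‖ := by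
    rw [farPoint, norm_smul, Real.norm_of_nonneg (by positivity)]
    simp
  have h2 : ‖c.1 m‖ ≤ ∑ m, ‖c.1 m‖ :=
    Finset.single_le_sum (f := fun m => ‖c.1 m‖) (fun _ _ => norm_nonneg _) (Finset.mem_univ m)
  rw [h] at h1
  linarith

/-- The section of `confInit` adding a point far away. -/
def confSection (n : ℕ) : C(Conf n (Set.univ : Set R3), Conf (n + 1) (Set.univ : Set R3)) where
  toFun c := confSnoc c (farPoint c) (farPoint_ne c)
  continuous_toFun := by
    refine continuous_confSnoc continuous_id ?_ _
    exact (continuous_const.add (continuous_finsetSum _ fun m _ =>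
      ((continuous_apply m).comp (continuous_conf_val _)).norm)).smul continuous_const

theorem confInit_confSection (c : Conf n (Set.univ : Set R3)) :
    confInit n (confSection n c) = c :=
  confInit_confSnoc c (farPoint c) (farPoint_ne c)

end Lifting

section SimplyConnected

open AffineMap in
theorem genLoop_homotopic_of_segment {N : Type*} {Q : Set R3} {b : (Qᶜ : Set R3)}
    (f g : GenLoop N (Qᶜ : Set R3) b)
    (h : ∀ (u : N → I) (s : I), lineMap (f u : R3) (g u : R3) (s : ℝ) ∉ Q) :
    GenLoop.Homotopic f g := by
  refine ⟨⟨⟨⟨fun x => ⟨lineMap (f x.2 : R3) (g x.2 : R3) (x.1 : ℝ), h x.2 x.1⟩, ?_⟩, ?_, ?_⟩, ?_⟩⟩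
  · have h1 : Continuous fun u => (f u : R3) := continuous_subtype_val.comp f.1.continuous
    have h2 : Continuous fun u => (g u : R3) := continuous_subtype_val.comp g.1.continuous
    refine Continuous.subtype_mk ?_ _
    simp only [lineMap_apply_module]
    fun_prop
  · exact fun u => Subtype.ext (by simp)
  · exact fun u => Subtype.ext (by simp)
  · intro s u hu
    refine Subtype.ext ?_
    have h1 : f u = b := f.2 u hu
    have h2 : g u = b := g.2 u hu
    change lineMap (f u : R3) (g u : R3) (s : ℝ) = (f u : R3)
    rw [h1, h2, lineMap_same_apply]

theorem exists_contDiff_approx {E : Type*} [NormedAddCommGroup E] [NormedSpace ℝ E] (γ : C(I, E))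
    {ε : ℝ} (hε : 0 < ε) : ∃ P : ℝ → E, ContDiff ℝ 1 P ∧ P 0 = γ 0 ∧ P 1 = γ 1 ∧
      ∀ t : I, dist (P t) (γ t) < ε := by
  obtain ⟨N, hN, hN0⟩ := (((bernsteinApproximation_uniform γ).eventually
    (Metric.ball_mem_nhds γ hε)).and (Filter.eventually_ne_atTop 0)).exists
  have hP : ∀ t : I, ∑ k : Fin (N + 1), ((N.choose k : ℝ) * (t : ℝ) ^ (k : ℕ) *
      (1 - (t : ℝ)) ^ (N - k)) • γ (bernstein.z k) = bernsteinApproximation N γ t := fun t => by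
    rw [bernsteinApproximation.apply]
    simp only [bernstein_apply]
  refine ⟨fun t => ∑ k : Fin (N + 1), ((N.choose k : ℝ) * t ^ (k : ℕ) *
      (1 - t) ^ (N - k)) • γ (bernstein.z k), by fun_prop, ?_, ?_, fun t => ?_⟩
  · exact (hP 0).trans (by simp)
  · exact (hP 1).trans (by simp [hN0])
  · change dist (∑ k : Fin (N + 1), _) _ < ε
    rw [hP]
    exact (ContinuousMap.dist_apply_le_dist t).trans_lt hN

theorem exists_generic_vector {P : ℝ → R3} (hP : ContDiff ℝ 1 P) {Q : Set R3} (hQ : Q.Finite)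
    (x : R3) {ε : ℝ} (hε : 0 < ε) : ∃ v : R3, ‖v‖ < ε ∧ ∀ q ∈ Q, ∀ r : ℝ, ∀ t ∈ Set.Ioo (0 : ℝ) 1,
      P t + (t * (1 - t)) • v ≠ x + r • (q - x) := by
  let φ : R3 → ℝ × ℝ → R3 := fun q u =>
    (u.2 * (1 - u.2))⁻¹ • (x + u.1 • (q - x) - P u.2)
  let D : Set (ℝ × ℝ) := Set.univ ×ˢ Set.Ioo (0 : ℝ) 1
  have hne : ∀ t ∈ Set.Ioo (0 : ℝ) 1, t * (1 - t) ≠ 0 := fun t ht =>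
    (mul_pos ht.1 (sub_pos.2 ht.2)).ne'
  have hφ : ∀ q, ContDiffOn ℝ 1 (φ q) D := fun q =>
    have h1 : ContDiffOn ℝ 1 (fun u : ℝ × ℝ => (u.2 * (1 - u.2))⁻¹) D :=
      ContDiffOn.inv (by fun_prop) fun u hu => hne u.2 hu.2
    have h2 : ContDiff ℝ 1 fun u : ℝ × ℝ => x + u.1 • (q - x) - P u.2 := by fun_prop
    h1.smul h2.contDiffOn
  have hD : Convex ℝ D := convex_univ.prod (convex_Ioo 0 1)
  have hlt : dimH (⋃ q ∈ Q, φ q '' D) < Module.finrank ℝ R3 := by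
    rw [dimH_bUnion hQ.countable]
    refine (iSup₂_le fun q _ => ?_ : _ ≤ (2 : ENNReal)).trans_lt ?_
    · refine (((hφ q).dimH_image_le hD subset_rfl).trans (dimH_mono (Set.subset_univ _))).trans ?_
      rw [Real.dimH_univ_eq_finrank]
      simp
    · rw [finrank_euclideanSpace_fin]
      norm_num
  obtain ⟨v, hv, hv'⟩ := (dense_compl_of_dimH_lt_finrank hlt).exists_dist_lt 0 hε
  refine ⟨v, by simpa using hv', fun q hq r t ht h => hv ?_⟩
  refine Set.mem_biUnion hq ⟨(r, t), ⟨trivial, ht⟩, ?_⟩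
  change (t * (1 - t))⁻¹ • (x + r • (q - x) - P t) = v
  rw [← h, add_sub_cancel_left, inv_smul_smul₀ (hne t ht)]

theorem genLoop_homotopic_const {Q : Set R3} (hQ : Q.Finite) {b : (Qᶜ : Set R3)}
    (f : GenLoop (Fin 1) (Qᶜ : Set R3) b) : GenLoop.Homotopic f GenLoop.const := by
  let γ : C(I, R3) := ⟨fun t => f fun _ => t,
    continuous_subtype_val.comp (f.1.continuous.comp (continuous_pi fun _ => continuous_id))⟩
  have hfγ : ∀ u : Fin 1 → I, (f u : R3) = γ (u 0) := fun u =>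
    congrArg (fun u => (f u : R3)) (funext fun i => by rw [Subsingleton.elim i 0])
  have hγ0 : γ 0 = b := congrArg Subtype.val (f.2 (fun _ => 0) ⟨0, .inl rfl⟩)
  have hγ1 : γ 1 = b := congrArg Subtype.val (f.2 (fun _ => 1) ⟨0, .inr rfl⟩)
  obtain ⟨δ, hδ, hsub⟩ := (isCompact_range γ.continuous).exists_thickening_subset_open
    hQ.isClosed.isOpen_compl (Set.range_subset_iff.2 fun t => (f fun _ => t).2)
  have hclose : ∀ (t : I) (z : R3), dist z (γ t) < δ → z ∉ Q := fun t z hz =>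
    hsub (Metric.mem_thickening_iff.2 ⟨_, ⟨t, rfl⟩, hz⟩)
  obtain ⟨P, hP, hP0, hP1, hPγ⟩ := exists_contDiff_approx γ (half_pos hδ)
  obtain ⟨v, hv, hgen⟩ := exists_generic_vector hP hQ b (half_pos hδ)
  let R : ℝ → R3 := fun t => P t + (t * (1 - t)) • v
  have hRc : Continuous R := by
    have := hP.continuous
    fun_prop
  have hRγ : ∀ t : I, dist (R t) (γ t) < δ := fun t => by
    have h1 : dist (R t) (P t) ≤ ‖v‖ := by
      rw [dist_self_add_left, norm_smul, Real.norm_eq_abs]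
      refine mul_le_of_le_one_left (norm_nonneg v) (abs_le.2 ⟨?_, ?_⟩) <;>
        nlinarith [t.2.1, t.2.2]
    linarith [dist_triangle (R t) (P t) (γ t), hPγ t]
  have hR0 : R 0 = b := by simp [R, hP0, hγ0]
  have hR1 : R 1 = b := by simp [R, hP1, hγ1]
  let g : GenLoop (Fin 1) (Qᶜ : Set R3) b :=
    ⟨⟨fun u => ⟨R (u 0), hclose (u 0) _ (hRγ (u 0))⟩, by
      refine Continuous.subtype_mk (hRc.comp ?_) _
      fun_prop⟩, fun u ⟨i, hi⟩ => Subtype.ext (by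
        rw [Subsingleton.elim i 0] at hi
        change R (u 0) = b
        rcases hi with hi | hi <;> rw [hi]
        exacts [hR0, hR1])⟩
  refine (genLoop_homotopic_of_segment f g fun u s => ?_).trans
    (genLoop_homotopic_of_segment g _ fun u s hs => ?_)
  · refine hclose (u 0) _ ?_
    change dist (AffineMap.lineMap (f u : R3) (R (u 0)) (s : ℝ)) _ < δ
    rw [hfγ, dist_lineMap_left, dist_comm]
    refine lt_of_le_of_lt (mul_le_of_le_one_left dist_nonneg ?_) (hRγ (u 0))
    rw [Real.norm_of_nonneg s.2.1]
    exact s.2.2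
  · change AffineMap.lineMap (R (u 0)) (b : R3) (s : ℝ) ∈ Q at hs
    by_cases hs1 : (s : ℝ) = 1
    · rw [hs1, AffineMap.lineMap_apply_one] at hs
      exact b.2 hs
    by_cases h0 : (u 0 : ℝ) = 0
    · rw [h0, hR0, AffineMap.lineMap_same_apply] at hs
      exact b.2 hs
    by_cases h1 : (u 0 : ℝ) = 1
    · rw [h1, hR1, AffineMap.lineMap_same_apply] at hs
      exact b.2 hs
    refine hgen _ hs (1 - (s : ℝ))⁻¹ (u 0)
      ⟨lt_of_le_of_ne (u 0).2.1 (Ne.symm h0), lt_of_le_of_ne (u 0).2.2 h1⟩ ?_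
    have h2 : 1 - (s : ℝ) ≠ 0 := sub_ne_zero.2 (Ne.symm hs1)
    have h3 : AffineMap.lineMap (R (u 0)) (b : R3) (s : ℝ) - (b : R3) =
        (1 - (s : ℝ)) • (R (u 0) - b) := by
      rw [AffineMap.lineMap_apply_module]
      module
    rw [h3, inv_smul_smul₀ h2]
    simp [R]

theorem subsingleton_homotopyGroup_one_compl {Q : Set R3} (hQ : Q.Finite) (b : (Qᶜ : Set R3)) :
    Subsingleton (π_ 1 (Qᶜ : Set R3) b) :=
  ⟨fun x y => Quotient.inductionOn₂ x y fun f g => Quotient.sound <|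
    (genLoop_homotopic_const hQ f).trans (genLoop_homotopic_const hQ g).symm⟩

end SimplyConnected

section Splitting

variable {n : ℕ}

theorem Qset_finite (n : ℕ) : (Qset n).Finite := (Set.finite_Icc 1 n).image _

theorem mem_Qset_iff {z : R3} : z ∈ Qset n ↔ ∃ m : Fin n, qpt (m + 1) = z := by
  constructor
  · rintro ⟨k, ⟨hk1, hkn⟩, rfl⟩
    exact ⟨⟨k - 1, by omega⟩, congrArg qpt (Nat.sub_add_cancel hk1)⟩
  · rintro ⟨m, rfl⟩
    exact ⟨m + 1, ⟨by omega, m.2⟩, rfl⟩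

theorem qpt_injective : Function.Injective qpt := fun k l h => by
  have h0 := congrArg (fun z : R3 => z 0) h
  simpa [qpt] using h0

/-- The configuration `(q_1, …, q_n)`. -/
def baseConf (n : ℕ) : Conf n (Set.univ : Set R3) :=
  ⟨fun m => qpt (m + 1), fun _ _ h => Fin.ext (Nat.succ_injective (qpt_injective h)),
    fun _ => trivial⟩

theorem ne_baseConf_iff {z : R3} : (∀ m, z ≠ (baseConf n).1 m) ↔ z ∈ (Qset n)ᶜ := by
  rw [Set.mem_compl_iff, mem_Qset_iff, not_exists]
  exact forall_congr' fun m => ne_comm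

/-- The inclusion of the fibre of `confInit` over `baseConf`. -/
def fiberMap (n : ℕ) : C(((Qset n)ᶜ : Set R3), Conf (n + 1) (Set.univ : Set R3)) where
  toFun z := confSnoc (baseConf n) z (ne_baseConf_iff.2 z.2)
  continuous_toFun := continuous_confSnoc continuous_const continuous_subtype_val _

theorem confInit_fiberMap (z : ((Qset n)ᶜ : Set R3)) : confInit n (fiberMap n z) = baseConf n :=
  confInit_confSnoc (baseConf n) z (ne_baseConf_iff.2 z.2)

theorem fiberMap_val_last (z : ((Qset n)ᶜ : Set R3)) :
    (fiberMap n z).1 (Fin.last n) = z :=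
  confSnoc_val_last (baseConf n) z (ne_baseConf_iff.2 z.2)

theorem isEmbedding_fiberMap (n : ℕ) : Topology.IsEmbedding (fiberMap n) := by
  have h : Continuous fun c : Conf (n + 1) (Set.univ : Set R3) => c.1 (Fin.last n) :=
    (continuous_apply _).comp (continuous_conf_val _)
  refine .of_comp (fiberMap n).continuous h ?_
  convert Topology.IsEmbedding.subtypeVal (p := (· ∈ (Qset n)ᶜ))
  exact funext fiberMap_val_last

theorem mem_range_fiberMap (c : Conf (n + 1) (Set.univ : Set R3))
    (h : confInit n c = baseConf n) : c ∈ Set.range (fiberMap n) := by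
  refine ⟨⟨c.1 (Fin.last n), ne_baseConf_iff.1 fun m => ?_⟩, ?_⟩
  · rw [← h]
    exact fun h => (Fin.castSucc_lt_last m).ne' (c.2.1 h)
  · exact conf_ext_last ((confInit_fiberMap _).trans h.symm) (fiberMap_val_last _)

/-- The basepoint of the fibre of `confInit` lying on the section `confSection`. -/
def fiberBase (n : ℕ) : ((Qset n)ᶜ : Set R3) :=
  ⟨farPoint (baseConf n), ne_baseConf_iff.1 (farPoint_ne _)⟩

/-- The action of a homeomorphism of `ℝ³` on configurations. -/
def confHomeomorph (h : R3 ≃ₜ R3) (n : ℕ) :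
    Conf n (Set.univ : Set R3) ≃ₜ Conf n (Set.univ : Set R3) where
  toFun c := ⟨fun m => h (c.1 m), h.injective.comp c.2.1, fun _ => trivial⟩
  invFun c := ⟨fun m => h.symm (c.1 m), h.symm.injective.comp c.2.1, fun _ => trivial⟩
  left_inv _ := Subtype.ext (funext fun _ => h.symm_apply_apply _)
  right_inv _ := Subtype.ext (funext fun _ => h.apply_symm_apply _)
  continuous_toFun := Continuous.subtype_mk (continuous_pi fun m : Fin n =>
    h.continuous.comp ((continuous_apply m).comp (continuous_conf_val _))) _
  continuous_invFun := Continuous.subtype_mk (continuous_pi fun m : Fin n =>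
    h.symm.continuous.comp ((continuous_apply m).comp (continuous_conf_val _))) _

theorem subsingleton_homotopyGroup_conf_zero {N : Type} (c : Conf 0 (Set.univ : Set R3)) :
    Subsingleton (HomotopyGroup N (Conf 0 (Set.univ : Set R3)) c) := by
  have : Subsingleton (Conf 0 (Set.univ : Set R3)) :=
    ⟨fun x y => Subtype.ext (Subsingleton.elim _ _)⟩
  exact ⟨fun x y => Quotient.inductionOn₂ x y fun f g =>
    congrArg _ (Subtype.ext (ContinuousMap.ext fun _ => Subsingleton.elim _ _))⟩

variable {N : Type} [DecidableEq N] [Nonempty N]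

theorem nonempty_mulEquiv_conf (c d : Conf n (Set.univ : Set R3)) :
    Nonempty (HomotopyGroup N (Conf n (Set.univ : Set R3)) c ≃*
      HomotopyGroup N (Conf n (Set.univ : Set R3)) d) :=
  let ⟨h, hh⟩ := exists_homeomorph_apply_eq c.2.1 d.2.1
  ⟨piCongr (confHomeomorph h n) (Subtype.ext (funext hh))⟩

theorem nonempty_mulEquiv_compl {Q : Set R3} (hQ : Q.Finite) (x y : (Qᶜ : Set R3)) :
    Nonempty (HomotopyGroup N (Qᶜ : Set R3) x ≃* HomotopyGroup N (Qᶜ : Set R3) y) := by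
  obtain ⟨h, hxy, hfix⟩ := exists_homeomorph_fixing hQ x.2 y.2
  have hQ' : ∀ z, z ∈ Qᶜ ↔ h z ∈ Qᶜ := fun z => not_congr
    ⟨fun hz => (hfix z hz).symm ▸ hz, fun hz => h.injective (hfix _ hz) ▸ hz⟩
  exact ⟨piCongr (h.subtype hQ') (Subtype.ext hxy)⟩

theorem nonempty_mulEquiv_conf_succ
    (hc : ∀ c, ∀ a b : HomotopyGroup N (Conf (n + 1) (Set.univ : Set R3)) c, a * b = b * a)
    (c : Conf (n + 1) (Set.univ : Set R3)) (d : Conf n (Set.univ : Set R3))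
    (b : ((Qset n)ᶜ : Set R3)) :
    Nonempty (HomotopyGroup N (Conf (n + 1) (Set.univ : Set R3)) c ≃*
      HomotopyGroup N (Conf n (Set.univ : Set R3)) d ×
        HomotopyGroup N ((Qset n)ᶜ : Set R3) b) := by
  obtain ⟨e₁⟩ := nonempty_mulEquiv_conf (N := N) c (confSection n (baseConf n))
  obtain ⟨e₂⟩ := nonempty_mulEquiv_prod (N := N) (hasRegularLifts_confInit n)
    (isEmbedding_fiberMap n) mem_range_fiberMap confInit_fiberMap
    (s := confSection n) confInit_confSection rfl
    (f₀ := fiberBase n) rfl (hc _)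
  obtain ⟨e₃⟩ := nonempty_mulEquiv_conf (N := N) (baseConf n) d
  obtain ⟨e₄⟩ := nonempty_mulEquiv_compl (N := N) (Qset_finite n) (fiberBase n) b
  exact ⟨e₁.trans (e₂.trans (e₃.prodCongr e₄))⟩

theorem subsingleton_homotopyGroup_one_conf (c : Conf n (Set.univ : Set R3)) :
    Subsingleton (π_ 1 (Conf n (Set.univ : Set R3)) c) := by
  induction n with
  | zero => exact subsingleton_homotopyGroup_conf_zero c
  | succ n ih =>
    obtain ⟨e⟩ := nonempty_mulEquiv_conf (N := Fin 1) c (confSection n (baseConf n))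
    refine e.toEquiv.subsingleton_congr.2 (subsingleton_of_forall_eq 1 fun a => ?_)
    obtain ⟨f, b, rfl⟩ := piMap_section_mul_surjective (hasRegularLifts_confInit n)
      (isEmbedding_fiberMap n) mem_range_fiberMap
      (s := confSection n) confInit_confSection rfl (f₀ := fiberBase n) rfl a
    have := ih (baseConf n)
    have := subsingleton_homotopyGroup_one_compl (Qset_finite n) (fiberBase n)
    rw [Subsingleton.elim f 1, Subsingleton.elim b 1, map_one, map_one, one_mul]

theorem nonempty_mulEquiv_pi
    (hc : ∀ n c, ∀ a b : HomotopyGroup N (Conf n (Set.univ : Set R3)) c, a * b = b * a)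
    (c : Conf n (Set.univ : Set R3)) (b : ∀ m : Fin n, ((Qset (m : ℕ))ᶜ : Set R3)) :
    Nonempty (HomotopyGroup N (Conf n (Set.univ : Set R3)) c ≃*
      ∀ m : Fin n, HomotopyGroup N ((Qset (m : ℕ))ᶜ : Set R3) (b m)) := by
  induction n with
  | zero =>
    have := subsingleton_homotopyGroup_conf_zero (N := N) c
    have := uniqueOfSubsingleton (1 : HomotopyGroup N (Conf 0 (Set.univ : Set R3)) c)
    exact ⟨MulEquiv.ofUnique⟩
  | succ n ih =>
    obtain ⟨e₁⟩ := nonempty_mulEquiv_conf_succ (hc (n + 1)) c (baseConf n) (b (Fin.last n))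
    obtain ⟨e₂⟩ := ih (baseConf n) fun m => b m.castSucc
    let e₃ : (∀ m : Fin (n + 1), HomotopyGroup N ((Qset (m : ℕ))ᶜ : Set R3) (b m)) ≃*
        HomotopyGroup N ((Qset n)ᶜ : Set R3) (b (Fin.last n)) ×
          ∀ m : Fin n, HomotopyGroup N ((Qset (m : ℕ))ᶜ : Set R3) (b m.castSucc) :=
      { (Fin.snocEquiv fun m : Fin (n + 1) =>
          HomotopyGroup N ((Qset (m : ℕ))ᶜ : Set R3) (b m)).symm with
        map_mul' := fun _ _ => rfl }
    exact ⟨(e₁.trans (e₂.prodCongr (.refl _))).trans (MulEquiv.prodComm.trans e₃.symm)⟩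

end Splitting

theorem nonempty_mulEquiv_pi_homotopyGroup (n j : ℕ) (c : Conf n (Set.univ : Set R3))
    (b : ∀ m : Fin n, ((Qset (m : ℕ))ᶜ : Set R3)) :
    Nonempty (π_ (j + 1) (Conf n (Set.univ : Set R3)) c ≃*
      ∀ m : Fin n, π_ (j + 1) ((Qset (m : ℕ))ᶜ : Set R3) (b m)) := by
  refine nonempty_mulEquiv_pi (fun n c x y => ?_) c b
  cases j with
  | zero =>
    have := subsingleton_homotopyGroup_one_conf c
    exact Subsingleton.elim _ _
  | succ j => exact mul_comm x y

end FadellNeuwirth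

/-- **Fadell--Neuwirth (Corollary 2.1).**  For `n ≥ 2` and `i ≥ 1`, and for any choice
of basepoints, there is a group isomorphism
`π_i(Conf_n(ℝ³)) ≅ ∏_{k=0}^{n−1} π_i(ℝ³ ∖ Q_k)`.
(Here `i` is written as `i - 1 + 1`, which equals `i` since `i ≥ 1`.) -/
theorem homotopyGroup_conf_splitting (n i : ℕ) (hn : 2 ≤ n) (hi : 1 ≤ i)
    (c : Conf n (Set.univ : Set R3))
    (b : ∀ m : Fin n, (((Qset (m : ℕ))ᶜ : Set R3))) :
    Nonempty
      ((π_ (i - 1 + 1) (Conf n (Set.univ : Set R3)) c) ≃*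
        (∀ m : Fin n, π_ (i - 1 + 1) (((Qset (m : ℕ))ᶜ : Set R3)) (b m))) := by
  exact FadellNeuwirth.nonempty_mulEquiv_pi_homotopyGroup n (i - 1) c b

end
end
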